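/- arXiv:2003.08885 — 6 statements merged into one kernel-verified Lean document; each statement's English description precedes it below -/
import Mathlib

section
/- Let N ≥ 4, let T₁, …, T_N be warps, and let B be an invertible 2×2 real matrix with det B > 0 such that Tᵢ B is also a warp for every i ∈ {1, …, N}. Suppose there exist four indices i₁, i₂, i₃, i₄ such that the four symmetric matrices T_{i₁}ᵀ T_{i₁}, T_{i₂}ᵀ T_{i₂}, T_{i₃}ᵀ T_{i₃}, T_{i₄}ᵀ T_{i₄} are affinely independent (viewed as points in the 3-dimensional real vector space of symmetric 2×2 matrices). Then B is a rotation matrix, i.e., Bᵀ B = I and det B = 1. -/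
open Matrix

/-- A 2×2 real matrix is a rotation matrix if it is orthogonal and has determinant 1. -/
def IsRotation (R : Matrix (Fin 2) (Fin 2) ℝ) : Prop :=
  Rᵀ * R = 1 ∧ R.det = 1

/-- A 2×2 real matrix is a warp if it can be written as `R₁ * diag(1, r) * R₂`
with `R₁, R₂` rotations and `0 < r ≤ 1`. -/
def IsWarp (T : Matrix (Fin 2) (Fin 2) ℝ) : Prop :=
  ∃ (R₁ R₂ : Matrix (Fin 2) (Fin 2) ℝ) (r : ℝ),
    IsRotation R₁ ∧ IsRotation R₂ ∧ 0 < r ∧ r ≤ 1 ∧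
    T = R₁ * Matrix.diagonal ![1, r] * R₂

lemma warp_eq {T : Matrix (Fin 2) (Fin 2) ℝ} (h : IsWarp T) :
    1 - (Tᵀ * T).trace + T.det ^ 2 = 0 := by
  obtain ⟨R₁, R₂, r, ⟨h1, d1⟩, ⟨h2, d2⟩, -, -, rfl⟩ := h
  have h2' : R₂ * R₂ᵀ = 1 := mul_eq_one_comm.mp h2
  have e : (R₁ * Matrix.diagonal ![1, r] * R₂)ᵀ * (R₁ * Matrix.diagonal ![1, r] * R₂)
      = R₂ᵀ * (Matrix.diagonal ![1, r] * Matrix.diagonal ![1, r] * R₂) := by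
    calc _ = R₂ᵀ * (Matrix.diagonal ![1, r] * (R₁ᵀ * R₁) * Matrix.diagonal ![1, r] * R₂) := by
          simp only [transpose_mul, diagonal_transpose, Matrix.mul_assoc]
      _ = _ := by rw [h1, Matrix.mul_one]
  rw [e, Matrix.trace_mul_comm, Matrix.mul_assoc, h2', Matrix.mul_one, det_mul, det_mul, d1, d2,
    det_diagonal, diagonal_mul_diagonal, trace_diagonal]
  simp [Fin.sum_univ_two]
  ring

/-- A linear map with components a symmetric functional and the antisymmetric part. -/
def pairMap (α q γ : ℝ) : Matrix (Fin 2) (Fin 2) ℝ →ₗ[ℝ] ℝ × ℝ where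
  toFun M := (α * M 0 0 - q * (M 0 1 + M 1 0) + γ * M 1 1, M 0 1 - M 1 0)
  map_add' M N := by ext <;> simp <;> ring
  map_smul' c M := by ext <;> simp <;> ring

lemma pairMap_zero {α q γ k : ℝ} {P : Fin 4 → Matrix (Fin 2) (Fin 2) ℝ}
    (hP : AffineIndependent ℝ P) (h : ∀ i, pairMap α q γ (P i) = (k, 0)) :
    α = 0 ∧ q = 0 ∧ γ = 0 := by
  have hli := (affineIndependent_iff_linearIndependent_vsub ℝ P 0).mp hP
  have hle : Submodule.span ℝ (Set.range fun i : {x : Fin 4 // x ≠ 0} => (P i -ᵥ P 0 :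
      Matrix (Fin 2) (Fin 2) ℝ)) ≤ LinearMap.ker (pairMap α q γ) := by
    rw [Submodule.span_le]
    rintro _ ⟨i, rfl⟩
    simp [h]
  have h3 := Submodule.finrank_mono hle
  rw [finrank_span_eq_card hli] at h3
  have hc : Fintype.card {x : Fin 4 // x ≠ 0} = 3 := by simp
  have hr := LinearMap.finrank_range_add_finrank_ker (pairMap α q γ)
  have hM : Module.finrank ℝ (Matrix (Fin 2) (Fin 2) ℝ) = 4 := by
    simp [Module.finrank_matrix]
  have h1 : Module.finrank ℝ (LinearMap.range (pairMap α q γ)) ≤ 1 := by omega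
  obtain ⟨v, hv⟩ := finrank_le_one_iff.mp h1
  have key : ∀ M, ∃ c : ℝ, c * v.1.1 = (pairMap α q γ M).1 ∧ c * v.1.2 = (pairMap α q γ M).2 := by
    intro M
    obtain ⟨c, hc⟩ := hv ⟨_, LinearMap.mem_range_self _ M⟩
    have := congrArg Subtype.val hc
    refine ⟨c, ?_, ?_⟩
    · simpa using congrArg Prod.fst this
    · simpa using congrArg Prod.snd this
  obtain ⟨a, a1, a2⟩ := key !![1, 0; 0, 0]
  obtain ⟨b, b1, b2⟩ := key !![0, 1; 0, 0]
  obtain ⟨c, c1, c2⟩ := key !![0, 0; 1, 0]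
  obtain ⟨d, d1, d2⟩ := key !![0, 0; 0, 1]
  simp only [pairMap, LinearMap.coe_mk, AddHom.coe_mk, of_apply, cons_val_zero, cons_val_one,
    cons_val', cons_val_fin_one] at a1 a2 b1 b2 c1 c2 d1 d2
  generalize v.1.1 = x at *
  generalize v.1.2 = y at *
  refine ⟨?_, ?_, ?_⟩
  · linear_combination (-b * y) * a1 + (b * x) * a2 - α * b2
  · linear_combination (b * y / 2) * (b1 + c1) - (b * x / 2) * (b2 + c2) - q * b2
  · linear_combination (-b * y) * d1 + (b * x) * d2 - γ * b2

theorem B_is_rotation_of_affine_independent (N : ℕ) (hN : 4 ≤ N)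
    (T : Fin N → Matrix (Fin 2) (Fin 2) ℝ) (hT : ∀ i, IsWarp (T i))
    (B : Matrix (Fin 2) (Fin 2) ℝ) (hBdet : 0 < B.det)
    (hTB : ∀ i, IsWarp (T i * B))
    (hAff : ∃ i₁ i₂ i₃ i₄ : Fin N,
      AffineIndependent ℝ
        ![(T i₁)ᵀ * T i₁, (T i₂)ᵀ * T i₂, (T i₃)ᵀ * T i₃, (T i₄)ᵀ * T i₄]) :
    IsRotation B := by
  obtain ⟨i₁, i₂, i₃, i₄, hA⟩ := hAff
  have key : ∀ i, pairMap (B.det ^ 2 - (B * Bᵀ) 0 0) ((B * Bᵀ) 0 1) (B.det ^ 2 - (B * Bᵀ) 1 1)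
      ((T i)ᵀ * T i) = (B.det ^ 2 - 1, 0) := by
    intro i
    have h1 := warp_eq (hT i)
    have h2 := warp_eq (hTB i)
    simp only [pairMap, LinearMap.coe_mk, AddHom.coe_mk]
    rw [det_mul] at h2
    simp only [det_fin_two, trace_fin_two, mul_apply, Fin.sum_univ_two, transpose_apply] at h1 h2 ⊢
    ext
    · simp only
      linear_combination h2 - (B 0 0 * B 1 1 - B 0 1 * B 1 0) ^ 2 * h1
    · simp only
      ring
  have hk := pairMap_zero (k := B.det ^ 2 - 1) hA (by
    intro j
    fin_cases j <;> exact key _)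
  obtain ⟨ha, hq, hg⟩ := hk
  have hd : B.det ^ 2 - 1 = 0 := by
    have := congrArg Prod.fst (key i₁)
    rw [ha, hq, hg] at this
    simpa [pairMap] using this.symm
  have hd1 : B.det = 1 := by nlinarith
  refine ⟨mul_eq_one_comm.mp ?_, hd1⟩
  have hs : (B * Bᵀ) 1 0 = (B * Bᵀ) 0 1 := by
    simp [mul_apply, mul_comm]
  ext i j
  fin_cases i <;> fin_cases j
  · simp only [Fin.zero_eta, one_apply_eq]; linarith
  · simpa using hq
  · simpa using hs.trans hq
  · simp only [Fin.mk_one, one_apply_eq]; linarith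
end

section
/- Let N ≥ 4, let T₁, …, T_N be warps and W₁, …, W_N be warps, let τ, σ ∈ ℝ² be linearly independent vectors and τ′, σ′ ∈ ℝ² be such that Wᵢ⁻¹ Tᵢ τ = τ′ and Wᵢ⁻¹ Tᵢ σ = σ′ for all i ∈ {1, …, N}. Suppose there exist four indices i₁, i₂, i₃, i₄ such that the four symmetric matrices T_{iⱼ}ᵀ T_{iⱼ} (j = 1, 2, 3, 4) are affinely independent as points of the 3-dimensional space of symmetric 2×2 matrices. Then there exists a rotation matrix B such that Wᵢ = Tᵢ B for all i ∈ {1, …, N}. -/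
open Matrix

lemma IsRotation.mul_transpose {R : Matrix (Fin 2) (Fin 2) ℝ} (h : IsRotation R) : R * Rᵀ = 1 :=
  mul_eq_one_comm.mp h.1

/-- The Gram matrix of a warp has eigenvalue 1. -/
lemma IsWarp.det_gram_sub {T : Matrix (Fin 2) (Fin 2) ℝ} (h : IsWarp T) :
    (Tᵀ * T - 1).det = 0 := by
  obtain ⟨R, Q, r, hR, hQ, -, -, rfl⟩ := h
  have e : (R * diagonal ![1, r] * Q)ᵀ * (R * diagonal ![1, r] * Q) - 1
      = Qᵀ * (diagonal ![1, r] * diagonal ![1, r] - 1) * Q := by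
    have : (R * diagonal ![1, r] * Q)ᵀ * (R * diagonal ![1, r] * Q)
        = Qᵀ * (diagonal ![1, r] * (Rᵀ * R) * diagonal ![1, r]) * Q := by
      simp only [transpose_mul, diagonal_transpose, Matrix.mul_assoc]
    rw [this, hR.1, Matrix.mul_sub, Matrix.sub_mul, Matrix.mul_one, Matrix.mul_one, hQ.1]
  rw [e, det_mul, det_mul]
  have : (diagonal ![1, r] * diagonal ![1, r] - 1 : Matrix (Fin 2) (Fin 2) ℝ).det = 0 := by
    simp [det_fin_two]
  rw [this]; simp

lemma IsWarp.det_pos {T : Matrix (Fin 2) (Fin 2) ℝ} (h : IsWarp T) : 0 < T.det := by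
  obtain ⟨R, Q, r, hR, hQ, hr, -, rfl⟩ := h
  rw [det_mul, det_mul, hR.2, hQ.2]
  simpa using hr

/-- An affine function on symmetric matrices constant on four affinely independent points
has zero linear part. -/
lemma affine_zero (S : Fin 4 → Matrix (Fin 2) (Fin 2) ℝ) (hS : AffineIndependent ℝ S)
    (hsym : ∀ i, S i 1 0 = S i 0 1) (x y z d : ℝ)
    (h : ∀ i, S i 0 0 * x + S i 0 1 * y + S i 1 1 * z = d) : x = 0 ∧ y = 0 ∧ z = 0 := by
  rw [affineIndependent_iff_linearIndependent_vsub ℝ S 0] at hS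
  have h1 := hS.comp (fun j : Fin 3 => (⟨j.succ, Fin.succ_ne_zero j⟩ : {x : Fin 4 // x ≠ 0}))
    (by intro a b hab; simpa using hab)
  let P : Matrix (Fin 3) (Fin 3) ℝ := Matrix.of fun j =>
    ![S j.succ 0 0 - S 0 0 0, S j.succ 0 1 - S 0 0 1, S j.succ 1 1 - S 0 1 1]
  let g : (Fin 3 → ℝ) →ₗ[ℝ] Matrix (Fin 2) (Fin 2) ℝ :=
    { toFun := fun v => !![v 0, v 1; v 1, v 2]
      map_add' := by intro u v; ext i j; fin_cases i <;> fin_cases j <;> simp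
      map_smul' := by intro u v; ext i j; fin_cases i <;> fin_cases j <;> simp }
  have h2 : LinearIndependent ℝ P.row := by
    apply LinearIndependent.of_comp g
    have e : ⇑g ∘ P.row = ((fun i : {x : Fin 4 // x ≠ 0} => S ↑i -ᵥ S 0) ∘
        fun j : Fin 3 => (⟨j.succ, Fin.succ_ne_zero j⟩ : {x : Fin 4 // x ≠ 0})) := by
      funext k
      ext i j
      fin_cases i <;> fin_cases j <;> simp [g, P, hsym, Matrix.row, Function.comp_apply] <;> rfl
    rw [e]
    exact h1
  have h3 : IsUnit P := Matrix.linearIndependent_rows_iff_isUnit.mp h2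
  have h4 : P *ᵥ ![x, y, z] = P *ᵥ 0 := by
    rw [mulVec_zero]
    funext j
    have a := h j.succ
    have b := h 0
    simp [P, mulVec, dotProduct, Fin.sum_univ_three]
    linarith
  have h5 := Matrix.mulVec_injective_of_isUnit h3 h4
  exact ⟨by simpa using congrFun h5 0, by simpa using congrFun h5 1, by simpa using congrFun h5 2⟩

theorem unique_geometry_and_texture (N : ℕ) (hN : 4 ≤ N)
    (T W : Fin N → Matrix (Fin 2) (Fin 2) ℝ)
    (hT : ∀ i, IsWarp (T i)) (hW : ∀ i, IsWarp (W i))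
    (τ σ τ' σ' : Fin 2 → ℝ) (hind : LinearIndependent ℝ ![τ, σ])
    (hτ : ∀ i, (W i)⁻¹ *ᵥ ((T i) *ᵥ τ) = τ')
    (hσ : ∀ i, (W i)⁻¹ *ᵥ ((T i) *ᵥ σ) = σ')
    (hAff : ∃ i₁ i₂ i₃ i₄ : Fin N,
      AffineIndependent ℝ
        ![(T i₁)ᵀ * T i₁, (T i₂)ᵀ * T i₂, (T i₃)ᵀ * T i₃, (T i₄)ᵀ * T i₄]) :
    ∃ B : Matrix (Fin 2) (Fin 2) ℝ, IsRotation B ∧ ∀ i, W i = T i * B := by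
  obtain ⟨i₁, i₂, i₃, i₄, hA⟩ := hAff
  have hC : IsUnit (Matrix.of ![τ, σ]) := by
    apply Matrix.linearIndependent_rows_iff_isUnit.mp
    exact hind
  have hC' : IsUnit (Matrix.of ![τ, σ])ᵀ := (Matrix.isUnit_transpose _).mpr hC
  have hmul : ∀ i, ((W i)⁻¹ * T i) * (Matrix.of ![τ, σ])ᵀ = (Matrix.of ![τ', σ'])ᵀ := by
    intro i
    have e1 := hτ i
    have e2 := hσ i
    rw [mulVec_mulVec] at e1 e2
    ext k l
    fin_cases l
    · exact congrFun e1 k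
    · exact congrFun e2 k
  obtain ⟨A, hA0⟩ : ∃ A, A = (W i₁)⁻¹ * T i₁ := ⟨_, rfl⟩
  have hTW : ∀ i, T i = W i * A := by
    intro i
    have : (W i)⁻¹ * T i = A := by
      apply hC'.mul_right_cancel
      rw [hmul, hA0, hmul]
    rw [← this, Matrix.mul_nonsing_inv_cancel_left _ _ (hW i).det_pos.ne'.isUnit]
  have hdet : 0 < A.det := by
    have h1 := (hT i₁).det_pos
    rw [hTW i₁, det_mul] at h1
    exact pos_of_mul_pos_right h1 (hW i₁).det_pos.le
  have hM : ∀ i, ((T i)ᵀ * T i - Aᵀ * A).det = 0 := by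
    intro i
    have : (T i)ᵀ * T i - Aᵀ * A = Aᵀ * ((W i)ᵀ * W i - 1) * A := by
      rw [Matrix.mul_sub, Matrix.sub_mul, Matrix.mul_one, hTW i]
      simp only [transpose_mul, Matrix.mul_assoc]
    rw [this, det_mul, det_mul, (hW i).det_gram_sub]; simp
  have hsymm : ∀ X : Matrix (Fin 2) (Fin 2) ℝ, (Xᵀ * X) 1 0 = (Xᵀ * X) 0 1 := by
    intro X
    simp [Matrix.mul_apply, Fin.sum_univ_two, mul_comm]
  obtain ⟨M, hMd⟩ : ∃ M, M = Aᵀ * A := ⟨_, rfl⟩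
  have hMs : M 1 0 = M 0 1 := by rw [hMd]; exact hsymm A
  have key : ∀ i, ((T i)ᵀ * T i) 0 0 * (M 1 1 - 1) + ((T i)ᵀ * T i) 0 1 * (-2 * M 0 1)
      + ((T i)ᵀ * T i) 1 1 * (M 0 0 - 1) = M 0 0 * M 1 1 - M 0 1 ^ 2 - 1 := by
    intro i
    have a := hM i
    have b := (hT i).det_gram_sub
    have c := hsymm (T i)
    rw [← hMd] at a
    generalize (T i)ᵀ * T i = S at a b c ⊢
    rw [det_fin_two] at a b
    simp [c, hMs] at a b
    linarith
  obtain ⟨hx, hy, hz⟩ := affine_zero _ hA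
    (by intro i; fin_cases i <;> exact hsymm _) (M 1 1 - 1) (-2 * M 0 1) (M 0 0 - 1)
    (M 0 0 * M 1 1 - M 0 1 ^ 2 - 1) (by intro i; fin_cases i <;> exact key _)
  have hM1 : Aᵀ * A = 1 := by
    rw [← hMd]
    ext i j
    fin_cases i <;> fin_cases j <;> simp <;> linarith
  have hM2 : A * Aᵀ = 1 := mul_eq_one_comm.mp hM1
  refine ⟨Aᵀ, ⟨by rw [transpose_transpose]; exact hM2, ?_⟩, ?_⟩
  · have := congrArg det hM1
    rw [det_mul, det_transpose, det_one] at this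
    rw [det_transpose]
    nlinarith
  · intro i
    rw [hTW i, Matrix.mul_assoc, hM2, Matrix.mul_one]
end

section
/- Let T be a warp and let B be an invertible 2×2 real matrix such that T B is also a warp. Then det(Tᵀ T − B⁻ᵀ B⁻¹) = 0, where B⁻ᵀ denotes the transpose of B⁻¹. -/
open Matrix

theorem warp_shifted_det_zero (T B : Matrix (Fin 2) (Fin 2) ℝ)
    (hT : IsWarp T) (hB : IsUnit B.det) (hTB : IsWarp (T * B)) :
    (Tᵀ * T - (B⁻¹)ᵀ * B⁻¹).det = 0 := by
  obtain ⟨R₁, R₂, r, ⟨h1, -⟩, ⟨h2, -⟩, -, -, h⟩ := hTB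
  have key : Bᵀ * (Tᵀ * T - (B⁻¹)ᵀ * B⁻¹) * B
      = R₂ᵀ * (Matrix.diagonal ![1, r] * Matrix.diagonal ![1, r] - 1) * R₂ := by
    have e1 : Bᵀ * (Tᵀ * T - (B⁻¹)ᵀ * B⁻¹) * B
        = (T * B)ᵀ * (T * B) - (B⁻¹ * B)ᵀ * (B⁻¹ * B) := by
      simp only [Matrix.transpose_mul]
      noncomm_ring
    rw [e1, Matrix.nonsing_inv_mul B hB, h]
    have e2 : (R₁ * Matrix.diagonal ![1, r] * R₂)ᵀ * (R₁ * Matrix.diagonal ![1, r] * R₂)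
        = R₂ᵀ * (Matrix.diagonal ![1, r] * (R₁ᵀ * R₁) * Matrix.diagonal ![1, r]) * R₂ := by
      simp only [Matrix.transpose_mul, Matrix.diagonal_transpose, Matrix.mul_assoc]
    rw [e2, h1, Matrix.mul_one, Matrix.mul_sub, Matrix.sub_mul, Matrix.mul_one, Matrix.mul_one R₂ᵀ, h2]
    simp
  have hd : (Matrix.diagonal ![1, r] * Matrix.diagonal ![1, r] - 1 :
      Matrix (Fin 2) (Fin 2) ℝ).det = 0 := by
    simp [Matrix.det_fin_two]
  have hk := congrArg Matrix.det key
  rw [Matrix.det_mul, Matrix.det_mul, Matrix.det_mul, Matrix.det_mul, hd,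
    Matrix.det_transpose] at hk
  have hb : B.det ≠ 0 := hB.ne_zero
  simpa [hb] using hk
end

section
/- Let T be a warp and let B be an invertible 2×2 real matrix such that T B is also a warp. Then the symmetric matrix Tᵀ T − B⁻ᵀ B⁻¹ is negative semidefinite, i.e., vᵀ (Tᵀ T − B⁻ᵀ B⁻¹) v ≤ 0 for every v ∈ ℝ². -/
open Matrix

theorem quad_eq (A : Matrix (Fin 2) (Fin 2) ℝ) (v : Fin 2 → ℝ) :
    v ⬝ᵥ ((Aᵀ * A) *ᵥ v) = (A *ᵥ v) ⬝ᵥ (A *ᵥ v) := by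
  rw [← Matrix.mulVec_mulVec, Matrix.dotProduct_mulVec, Matrix.vecMul_transpose]

theorem IsRotation.norm_eq {R : Matrix (Fin 2) (Fin 2) ℝ} (h : IsRotation R)
    (v : Fin 2 → ℝ) : (R *ᵥ v) ⬝ᵥ (R *ᵥ v) = v ⬝ᵥ v := by
  rw [← quad_eq, h.1, Matrix.one_mulVec]

theorem IsWarp.norm_le {S : Matrix (Fin 2) (Fin 2) ℝ} (h : IsWarp S)
    (v : Fin 2 → ℝ) : (S *ᵥ v) ⬝ᵥ (S *ᵥ v) ≤ v ⬝ᵥ v := by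
  obtain ⟨R₁, R₂, r, h₁, h₂, h0, hr, rfl⟩ := h
  rw [← Matrix.mulVec_mulVec, ← Matrix.mulVec_mulVec, h₁.norm_eq, ← h₂.norm_eq v]
  generalize R₂ *ᵥ v = w
  simp only [dotProduct, Fin.sum_univ_two, Matrix.mulVec_diagonal]
  simp
  have : r * r ≤ 1 := by nlinarith
  nlinarith [mul_self_nonneg (w 1)]

theorem warp_shifted_neg_semidef (T B : Matrix (Fin 2) (Fin 2) ℝ)
    (hT : IsWarp T) (hB : IsUnit B.det) (hTB : IsWarp (T * B)) :
    ∀ v : Fin 2 → ℝ, v ⬝ᵥ ((Tᵀ * T - (B⁻¹)ᵀ * B⁻¹) *ᵥ v) ≤ 0 := by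
  intro v
  rw [Matrix.sub_mulVec, dotProduct_sub, quad_eq, quad_eq]
  have h := hTB.norm_le (B⁻¹ *ᵥ v)
  rw [Matrix.mulVec_mulVec, Matrix.mul_assoc, Matrix.mul_nonsing_inv B hB, Matrix.mul_one] at h
  linarith
end

section
/- Fix λ ∈ (0, 1) and let (x, y) ∈ ℝ² satisfy λ ≤ x² + y² < 1. Define z = √(1 − x² − y²), φ = (1/2)·arccos(λ/(x² + y²)), T(x, y) = (1/√(x² + y²)) · [[x, y], [−y, x]] · diag(1, z) · R(φ) with R(φ) = [[cos φ, −sin φ], [sin φ, cos φ]], and B = diag(1/√(1+λ), 1/√(1−λ)). Then W(x, y) = T(x, y) · B is a warp, even though B is not an orthogonal matrix. -/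
open Matrix

lemma diag_two (a b : ℝ) : Matrix.diagonal ![a, b] = !![a, 0; 0, b] := by
  ext i j; fin_cases i <;> fin_cases j <;> simp

lemma warp_of_entries (a b c d u v p q r : ℝ) (hN : 0 < u ^ 2 + v ^ 2)
    (h1 : a * u + b * v = p) (h2 : c * u + d * v = q)
    (h3 : a * p + c * q = u) (h4 : b * p + d * q = v)
    (hr : a * d - b * c = r) (hr0 : 0 < r) (hr1 : r ≤ 1) :
    IsWarp !![a, b; c, d] := by
  obtain ⟨n, hn, hnn⟩ : ∃ n : ℝ, 0 < n ∧ n ^ 2 = u ^ 2 + v ^ 2 :=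
    ⟨Real.sqrt (u ^ 2 + v ^ 2), Real.sqrt_pos.2 hN, Real.sq_sqrt hN.le⟩
  have hpq : p ^ 2 + q ^ 2 = n ^ 2 := by
    rw [hnn]; linear_combination (-p) * h1 - q * h2 + u * h3 + v * h4
  have e1 : d * u - c * v = r * p := by
    rw [← hr, ← h3, ← h4]; ring
  have e2 : a * v - b * u = r * q := by
    rw [← hr, ← h3, ← h4]; ring
  refine ⟨!![p / n, -(q / n); q / n, p / n], !![u / n, v / n; -(v / n), u / n], r,
    ⟨?_, ?_⟩, ⟨?_, ?_⟩, hr0, hr1, ?_⟩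
  · ext i j; fin_cases i <;> fin_cases j <;>
      simp [Matrix.mul_apply, Fin.sum_univ_two] <;> field_simp <;> linarith
  · simp [Matrix.det_fin_two]; field_simp; linarith
  · ext i j; fin_cases i <;> fin_cases j <;>
      simp [Matrix.mul_apply, Fin.sum_univ_two] <;> field_simp <;> linarith
  · simp [Matrix.det_fin_two]; field_simp; linarith
  · rw [diag_two]
    ext i j; fin_cases i <;> fin_cases j <;>
      simp [Matrix.mul_apply, Fin.sum_univ_two] <;> field_simp <;> rw [hnn]
    · linear_combination u * h1 + v * e2
    · linear_combination v * h1 - u * e2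
    · linear_combination u * h2 - v * e1
    · linear_combination v * h2 + u * e1

lemma warp_core (lam x y s m z C S al be : ℝ) (hlam0 : 0 < lam) (hlam1 : lam < 1)
    (hs : x ^ 2 + y ^ 2 = s) (hlo : lam ≤ s) (hhi : s < 1)
    (hm : 0 < m) (hm2 : m ^ 2 = s) (hz : 0 < z) (hz2 : z ^ 2 = 1 - s)
    (hCS : C ^ 2 + S ^ 2 = 1) (hD : s * (C ^ 2 - S ^ 2) = lam)
    (ha : 0 < al) (ha2 : al ^ 2 = 1 + lam) (hb : 0 < be) (hb2 : be ^ 2 = 1 - lam) :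
    IsWarp !![(x * C + y * z * S) / (m * al), (-x * S + y * z * C) / (m * be);
      (-y * C + x * z * S) / (m * al), (y * S + x * z * C) / (m * be)] := by
  have hs' : x ^ 2 + y ^ 2 = m ^ 2 := by rw [hs, hm2]
  refine warp_of_entries _ _ _ _ (-al * S) (be * C)
    ((-2 * x * S * C + y * z * (C ^ 2 - S ^ 2)) / m)
    ((2 * y * S * C + x * z * (C ^ 2 - S ^ 2)) / m) (z / (al * be)) ?_ ?_ ?_ ?_ ?_ ?_ ?_ ?_
  · have : (-al * S) ^ 2 + (be * C) ^ 2 = (1 + lam) * S ^ 2 + (1 - lam) * C ^ 2 := by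
      rw [← ha2, ← hb2]; ring
    rw [this]
    nlinarith [sq_nonneg S, sq_nonneg C]
  · field_simp; ring
  · field_simp; ring
  · field_simp
    rw [ha2]
    linear_combination (-2 * S * C ^ 2 + z ^ 2 * S * (C ^ 2 - S ^ 2)) * hs'
      + m ^ 2 * S * (C ^ 2 - S ^ 2) * hz2 - m ^ 2 * S * hD - m ^ 2 * S * hCS
  · field_simp
    rw [hb2]
    linear_combination (2 * S ^ 2 * C + z ^ 2 * C * (C ^ 2 - S ^ 2)) * hs'
      + m ^ 2 * C * (C ^ 2 - S ^ 2) * hz2 - m ^ 2 * C * hD + m ^ 2 * C * hCS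
  · field_simp
    linear_combination z * (C ^ 2 + S ^ 2) * hs' + z * m ^ 2 * hCS
  · positivity
  · rw [div_le_one (by positivity)]
    refine (sq_le_sq₀ hz.le (by positivity)).1 ?_
    rw [mul_pow, hz2, ha2, hb2]; nlinarith

theorem hemisphere_ambiguity (lam x y : ℝ) (hlam0 : 0 < lam) (hlam1 : lam < 1)
    (hlo : lam ≤ x ^ 2 + y ^ 2) (hhi : x ^ 2 + y ^ 2 < 1) :
    IsWarp
      ((1 / Real.sqrt (x ^ 2 + y ^ 2)) •
        (!![x, y; -y, x] *
         Matrix.diagonal ![1, Real.sqrt (1 - x ^ 2 - y ^ 2)] *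
         !![Real.cos ((1 / 2) * Real.arccos (lam / (x ^ 2 + y ^ 2))),
            -Real.sin ((1 / 2) * Real.arccos (lam / (x ^ 2 + y ^ 2)));
            Real.sin ((1 / 2) * Real.arccos (lam / (x ^ 2 + y ^ 2))),
            Real.cos ((1 / 2) * Real.arccos (lam / (x ^ 2 + y ^ 2)))]) *
        Matrix.diagonal ![1 / Real.sqrt (1 + lam), 1 / Real.sqrt (1 - lam)]) ∧
    ¬((Matrix.diagonal ![1 / Real.sqrt (1 + lam), 1 / Real.sqrt (1 - lam)])ᵀ *
        Matrix.diagonal ![1 / Real.sqrt (1 + lam), 1 / Real.sqrt (1 - lam)] =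
        (1 : Matrix (Fin 2) (Fin 2) ℝ)) := by
  have hs0 : 0 < x ^ 2 + y ^ 2 := by linarith
  have h1p : 0 < 1 + lam := by linarith
  have h1m : 0 < 1 - lam := by linarith
  have hzz : 0 < 1 - x ^ 2 - y ^ 2 := by linarith
  constructor
  · have hcos : Real.cos (2 * ((1 / 2) * Real.arccos (lam / (x ^ 2 + y ^ 2)))) =
        lam / (x ^ 2 + y ^ 2) := by
      rw [← mul_assoc, show (2 : ℝ) * (1 / 2) = 1 by norm_num, one_mul]
      refine Real.cos_arccos ?_ ?_
      · have : 0 < lam / (x ^ 2 + y ^ 2) := by positivity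
        linarith
      · rwa [div_le_one hs0]
    generalize (1 / 2) * Real.arccos (lam / (x ^ 2 + y ^ 2)) = t at hcos ⊢
    have hCS := Real.cos_sq_add_sin_sq t
    have hD : (x ^ 2 + y ^ 2) * (Real.cos t ^ 2 - Real.sin t ^ 2) = lam := by
      rw [← Real.cos_two_mul', hcos]; field_simp
    have hm := Real.sqrt_pos.2 hs0
    have ha := Real.sqrt_pos.2 h1p
    have hb := Real.sqrt_pos.2 h1m
    have key := warp_core lam x y _ _ _ _ _ _ _ hlam0 hlam1 rfl hlo hhi
      hm (Real.sq_sqrt hs0.le) (Real.sqrt_pos.2 hzz)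
      ((Real.sq_sqrt hzz.le).trans (by ring)) hCS hD
      ha (Real.sq_sqrt h1p.le) hb (Real.sq_sqrt h1m.le)
    convert key using 1
    rw [diag_two, diag_two]
    ext i j; fin_cases i <;> fin_cases j <;>
      simp [Matrix.mul_apply, Fin.sum_univ_two] <;> field_simp <;> try ring
  · intro h
    have h0 := congrFun (congrFun h 0) 0
    simp [Matrix.mul_apply, Matrix.diagonal] at h0
    rw [← mul_inv, Real.mul_self_sqrt h1p.le, inv_eq_one] at h0
    linarith
end

section
/- Let a, b, c ∈ ℝ, not all zero, and let S ⊆ ℝ³ be the intersection of the cone {(x, y, z) : y² = x z} with the translated cone {(x, y, z) : (y + b)² = (x + a)(z + c)}. Then S cannot be the union of two distinct lines that intersect in a point; i.e., there do not exist two distinct lines L₁, L₂ ⊆ ℝ³ with L₁ ∩ L₂ ≠ ∅ and S = L₁ ∪ L₂. -/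
/-- A line in ℝ³: the set `{p + t • d : t ∈ ℝ}` for some point `p` and nonzero direction `d`. -/
def IsLine (L : Set (ℝ × ℝ × ℝ)) : Prop :=
  ∃ (p d : ℝ × ℝ × ℝ), d ≠ 0 ∧ L = {q | ∃ t : ℝ, q = p + t • d}

/-- A real line lying on the cone `y² = xz` passes through the apex. -/
lemma line_through_apex (x y z d e f : ℝ) (hd : ¬(d = 0 ∧ e = 0 ∧ f = 0))
    (H : ∀ t : ℝ, (y + t * e) ^ 2 = (x + t * d) * (z + t * f)) :
    ∃ s : ℝ, x + s * d = 0 ∧ y + s * e = 0 ∧ z + s * f = 0 := by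
  have h0 := H 0
  have h1 := H 1
  have h2 := H (-1)
  have A : y ^ 2 = x * z := by linarith
  have B : e ^ 2 = d * f := by linarith
  have C : 2 * y * e = x * f + z * d := by linarith
  by_cases hd0 : d = 0
  · subst hd0
    have he : e = 0 := by
      have : e ^ 2 = 0 := by rw [B]; ring
      exact pow_eq_zero_iff (two_ne_zero) |>.1 this
    subst he
    have hf : f ≠ 0 := fun hf => hd ⟨rfl, rfl, hf⟩
    have hx : x = 0 := by
      have : x * f = 0 := by linarith
      exact (mul_eq_zero.1 this).resolve_right hf
    subst hx
    have hy : y = 0 := by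
      have : y ^ 2 = 0 := by rw [A]; ring
      exact pow_eq_zero_iff (two_ne_zero) |>.1 this
    subst hy
    refine ⟨-z / f, by ring, by ring, by field_simp; ring⟩
  · have h1 : y * d - x * e = 0 := by
      have : (y * d - x * e) ^ 2 = 0 := by
        linear_combination d ^ 2 * A + x ^ 2 * B - x * d * C
      exact pow_eq_zero_iff (two_ne_zero) |>.1 this
    have h2 : z * d - x * f = 0 := by
      have : d * (z * d - x * f) = 0 := by
        linear_combination (-d) * C + 2 * e * h1 + 2 * x * B
      exact (mul_eq_zero.1 this).resolve_left hd0
    refine ⟨-x / d, by field_simp; ring, ?_, ?_⟩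
    · field_simp; linarith
    · field_simp; linarith

/-- A line in both cones is the line through both apexes. -/
lemma line_eq_span (a b c : ℝ) (h : ¬(a = 0 ∧ b = 0 ∧ c = 0)) (L : Set (ℝ × ℝ × ℝ))
    (hL : IsLine L)
    (hs : L ⊆ {p : ℝ × ℝ × ℝ | p.2.1 ^ 2 = p.1 * p.2.2 ∧
        (p.2.1 + b) ^ 2 = (p.1 + a) * (p.2.2 + c)}) :
    L = {q | ∃ r : ℝ, q = r • (a, b, c)} := by
  obtain ⟨⟨x, y, z⟩, ⟨d, e, f⟩, hd, rfl⟩ := hL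
  have hd' : ¬(d = 0 ∧ e = 0 ∧ f = 0) := by
    rintro ⟨rfl, rfl, rfl⟩
    exact hd rfl
  have H := fun t : ℝ => hs ⟨t, rfl⟩
  simp only [Set.mem_setOf_eq, Prod.smul_mk, Prod.mk_add_mk, smul_eq_mul] at H
  obtain ⟨s, s1, s2, s3⟩ := line_through_apex x y z d e f hd' fun t => (H t).1
  obtain ⟨u, u1, u2, u3⟩ := line_through_apex (x + a) (y + b) (z + c) d e f hd' fun t => by
    linear_combination (H t).2
  have k1 : a = (s - u) * d := by linarith
  have k2 : b = (s - u) * e := by linarith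
  have k3 : c = (s - u) * f := by linarith
  have hk : s - u ≠ 0 := by
    intro hk
    exact h ⟨by rw [k1, hk, zero_mul], by rw [k2, hk, zero_mul], by rw [k3, hk, zero_mul]⟩
  ext ⟨q1, q2, q3⟩
  simp only [Set.mem_setOf_eq, Prod.smul_mk, Prod.mk_add_mk, smul_eq_mul, Prod.mk.injEq]
  constructor
  · rintro ⟨t, rfl, rfl, rfl⟩
    have hr : (t - s) / (s - u) * (s - u) = t - s := div_mul_cancel₀ _ hk
    refine ⟨(t - s) / (s - u), ?_, ?_, ?_⟩
    · rw [k1, ← mul_assoc, hr]; linarith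
    · rw [k2, ← mul_assoc, hr]; linarith
    · rw [k3, ← mul_assoc, hr]; linarith
  · rintro ⟨r, rfl, rfl, rfl⟩
    refine ⟨s + r * (s - u), ?_, ?_, ?_⟩
    · rw [k1]; linarith
    · rw [k2]; linarith
    · rw [k3]; linarith

theorem cone_intersection_not_two_intersecting_lines (a b c : ℝ)
    (h : ¬(a = 0 ∧ b = 0 ∧ c = 0)) :
    ¬ ∃ L₁ L₂ : Set (ℝ × ℝ × ℝ), IsLine L₁ ∧ IsLine L₂ ∧ L₁ ≠ L₂ ∧
      (L₁ ∩ L₂).Nonempty ∧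
      {p : ℝ × ℝ × ℝ | p.2.1 ^ 2 = p.1 * p.2.2 ∧
        (p.2.1 + b) ^ 2 = (p.1 + a) * (p.2.2 + c)} = L₁ ∪ L₂ := by
  rintro ⟨L₁, L₂, h1, h2, hne, -, hS⟩
  apply hne
  rw [line_eq_span a b c h L₁ h1 (hS ▸ Set.subset_union_left),
    line_eq_span a b c h L₂ h2 (hS ▸ Set.subset_union_right)]
end
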